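/- Let k ≥ 1, E_k = [I_k | 0], F_k = [0 | I_k] ∈ ℝ^{k×(k+1)}, and let T̂₃ = [[-I_k ⊗ F_k, -E_k ⊗ I_k],[I_k ⊗ E_k, F_k ⊗ I_k]] ∈ ℝ^{2k²×2k(k+1)}. Then T̂₃ T̂₃^T = 2I_{2k²} - [[0, Ŵ],[Ŵ^T, 0]] where Ŵ = I_k ⊗ (F_k E_k^T) + (E_k F_k^T) ⊗ I_k, and consequently σ_min(T̂₃) = √(2 - σ_max(Ŵ)) = √(2 - 2cos(π/(2k))) = 2 sin(π/(4k)). -/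

import Mathlib

open Matrix Kronecker

/-- The smallest singular value of a real matrix `M` (with full row rank, `m ≤ n`):
the infimum of `‖uᵀM‖₂` over unit vectors `u`. -/
noncomputable def sigmaMin {m n : Type*} [Fintype m] [Fintype n] (M : Matrix m n ℝ) : ℝ :=
  sInf {r : ℝ | ∃ u : m → ℝ, ∑ i, (u i) ^ 2 = 1 ∧
    r = Real.sqrt (∑ j, (Matrix.vecMul u M j) ^ 2)}

/-- The largest singular value of a real matrix `M`. -/
noncomputable def sigmaMax {m n : Type*} [Fintype m] [Fintype n] (M : Matrix m n ℝ) : ℝ :=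
  sSup {r : ℝ | ∃ v : n → ℝ, ∑ j, (v j) ^ 2 = 1 ∧
    r = Real.sqrt (∑ i, (M.mulVec v i) ^ 2)}

lemma aux_sum1 (k : ℕ) (x : Fin k) (f : ℕ → ℝ) :
    ∑ y : Fin k, (if (y : ℕ) = (x : ℕ) + 1 then (1 : ℝ) else 0) * f y
      = if (x : ℕ) + 1 < k then f (x + 1) else 0 := by
  split_ifs with h
  · rw [Finset.sum_eq_single (⟨x + 1, h⟩ : Fin k)]
    · simp
    · intro b _ hb
      rw [if_neg, zero_mul]
      intro h'
      exact hb (Fin.ext h')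
    · simp
  · apply Finset.sum_eq_zero
    intro y _
    rw [if_neg, zero_mul]
    have := y.2
    omega

lemma aux_sum2 (k : ℕ) (x : Fin k) (f : ℕ → ℝ) :
    ∑ y : Fin k, (if (x : ℕ) = (y : ℕ) + 1 then (1 : ℝ) else 0) * f y
      = if 0 < (x : ℕ) then f (x - 1) else 0 := by
  have hx := x.2
  split_ifs with h
  · rw [Finset.sum_eq_single (⟨x - 1, by omega⟩ : Fin k)]
    · simp; omega
    · intro b _ hb
      rw [if_neg, zero_mul]
      intro h'
      exact hb (Fin.ext (by simp; omega))
    · simp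
  · apply Finset.sum_eq_zero
    intro y _
    rw [if_neg, zero_mul]
    omega

lemma aux_FE (k : ℕ) (E F : Matrix (Fin k) (Fin (k + 1)) ℝ)
    (hE : ∀ i j, E i j = if (j : ℕ) = (i : ℕ) then 1 else 0)
    (hF : ∀ i j, F i j = if (j : ℕ) = (i : ℕ) + 1 then 1 else 0) (i j : Fin k) :
    (F * Eᵀ) i j = if (j : ℕ) = (i : ℕ) + 1 then 1 else 0 := by
  rw [Matrix.mul_apply, Finset.sum_eq_single j.castSucc]
  · simp [hE, hF]
  · intro b _ hb
    rw [Matrix.transpose_apply, hE j b, if_neg, mul_zero]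
    intro h
    exact hb (Fin.ext h)
  · simp

lemma aux_EE (k : ℕ) (E : Matrix (Fin k) (Fin (k + 1)) ℝ)
    (hE : ∀ i j, E i j = if (j : ℕ) = (i : ℕ) then 1 else 0) : E * Eᵀ = 1 := by
  ext i j
  rw [Matrix.mul_apply, Finset.sum_eq_single j.castSucc]
  · simp [hE, Matrix.one_apply, Fin.ext_iff, eq_comm]
  · intro b _ hb
    rw [Matrix.transpose_apply, hE j b, if_neg, mul_zero]
    intro h
    exact hb (Fin.ext h)
  · simp

lemma aux_FF (k : ℕ) (F : Matrix (Fin k) (Fin (k + 1)) ℝ)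
    (hF : ∀ i j, F i j = if (j : ℕ) = (i : ℕ) + 1 then 1 else 0) : F * Fᵀ = 1 := by
  ext i j
  rw [Matrix.mul_apply, Finset.sum_eq_single j.succ]
  · simp [hF, Matrix.one_apply, Fin.ext_iff, eq_comm]
  · intro b _ hb
    rw [Matrix.transpose_apply, hF j b, if_neg, mul_zero]
    intro h
    exact hb (Fin.ext (by simpa using h))
  · simp

lemma aux_W (k : ℕ) (E F : Matrix (Fin k) (Fin (k + 1)) ℝ)
    (hE : ∀ i j, E i j = if (j : ℕ) = (i : ℕ) then 1 else 0)
    (hF : ∀ i j, F i j = if (j : ℕ) = (i : ℕ) + 1 then 1 else 0)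
    (W : Matrix (Fin k × Fin k) (Fin k × Fin k) ℝ)
    (hW : W = (1 : Matrix (Fin k) (Fin k) ℝ) ⊗ₖ (F * Eᵀ) +
      (E * Fᵀ) ⊗ₖ (1 : Matrix (Fin k) (Fin k) ℝ)) (a b a' b' : Fin k) :
    W (a, b) (a', b') = (1 : Matrix (Fin k) (Fin k) ℝ) a a' *
        (if (b' : ℕ) = (b : ℕ) + 1 then 1 else 0) +
      (if (a : ℕ) = (a' : ℕ) + 1 then 1 else 0) * (1 : Matrix (Fin k) (Fin k) ℝ) b b' := by
  have h : E * Fᵀ = (F * Eᵀ)ᵀ := by simp [Matrix.transpose_mul]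
  rw [hW, h, Matrix.add_apply, Matrix.kroneckerMap_apply, Matrix.kroneckerMap_apply,
    Matrix.transpose_apply, aux_FE k E F hE hF, aux_FE k E F hE hF]

lemma aux_TT (k : ℕ) (E F : Matrix (Fin k) (Fin (k + 1)) ℝ)
    (hE : E * Eᵀ = 1) (hF : F * Fᵀ = 1) :
    (Matrix.fromBlocks
      (-((1 : Matrix (Fin k) (Fin k) ℝ) ⊗ₖ F)) (-(E ⊗ₖ (1 : Matrix (Fin k) (Fin k) ℝ)))
      ((1 : Matrix (Fin k) (Fin k) ℝ) ⊗ₖ E) (F ⊗ₖ (1 : Matrix (Fin k) (Fin k) ℝ))) *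
    (Matrix.fromBlocks
      (-((1 : Matrix (Fin k) (Fin k) ℝ) ⊗ₖ F)) (-(E ⊗ₖ (1 : Matrix (Fin k) (Fin k) ℝ)))
      ((1 : Matrix (Fin k) (Fin k) ℝ) ⊗ₖ E) (F ⊗ₖ (1 : Matrix (Fin k) (Fin k) ℝ)))ᵀ
    = (2 : ℝ) • (1 : Matrix ((Fin k × Fin k) ⊕ (Fin k × Fin k))
        ((Fin k × Fin k) ⊕ (Fin k × Fin k)) ℝ) - Matrix.fromBlocks 0
        ((1 : Matrix (Fin k) (Fin k) ℝ) ⊗ₖ (F * Eᵀ) +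
      (E * Fᵀ) ⊗ₖ (1 : Matrix (Fin k) (Fin k) ℝ))
        ((1 : Matrix (Fin k) (Fin k) ℝ) ⊗ₖ (F * Eᵀ) +
      (E * Fᵀ) ⊗ₖ (1 : Matrix (Fin k) (Fin k) ℝ))ᵀ 0 := by
  rw [← Matrix.fromBlocks_one, Matrix.fromBlocks_smul, Matrix.fromBlocks_transpose,
    Matrix.fromBlocks_multiply, sub_eq_add_neg, Matrix.fromBlocks_neg, Matrix.fromBlocks_add]
  simp only [Matrix.transpose_neg, Matrix.transpose_add, Matrix.neg_mul, Matrix.mul_neg, neg_neg,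
    ← Matrix.kroneckerMap_transpose, ← Matrix.mul_kronecker_mul, Matrix.transpose_one, mul_one,
    hE, hF, Matrix.one_kronecker_one, Matrix.transpose_mul, Matrix.transpose_transpose]
  congr 1
  · rw [two_smul]; simp
  · simp [add_comm]
  · simp [add_comm]
  · rw [two_smul]; simp

lemma aux_schur {m n : Type*} [Fintype m] [Fintype n] (W : Matrix m n ℝ) (c : ℝ)
    (p : m → ℝ) (q : n → ℝ) (hp : ∀ i, 0 < p i) (hq : ∀ j, 0 < q j) (hW : ∀ i j, 0 ≤ W i j)
    (h1 : ∀ i, ∑ j, W i j * q j ≤ c * p i) (h2 : ∀ j, ∑ i, W i j * p i ≤ c * q j)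
    (u : m → ℝ) (v : n → ℝ) :
    2 * (u ⬝ᵥ W *ᵥ v) ≤ c * (∑ i, u i ^ 2 + ∑ j, v j ^ 2) := by
  have key : ∀ i j, 2 * (u i * (W i j * v j)) ≤
      u i ^ 2 / p i * (W i j * q j) + v j ^ 2 / q j * (W i j * p i) := by
    intro i j
    have hpi := hp i
    have hqj := hq j
    have : u i ^ 2 / p i * (W i j * q j) + v j ^ 2 / q j * (W i j * p i)
        - 2 * (u i * (W i j * v j)) = W i j * ((u i * q j - v j * p i) ^ 2 / (p i * q j)) := by
      field_simp
      ring
    have h3 : 0 ≤ W i j * ((u i * q j - v j * p i) ^ 2 / (p i * q j)) :=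
      mul_nonneg (hW i j) (by positivity)
    linarith
  calc 2 * (u ⬝ᵥ W *ᵥ v) = ∑ i, ∑ j, 2 * (u i * (W i j * v j)) := by
        simp only [dotProduct, Matrix.mulVec, Finset.mul_sum]
    _ ≤ ∑ i, ∑ j, (u i ^ 2 / p i * (W i j * q j) + v j ^ 2 / q j * (W i j * p i)) :=
        Finset.sum_le_sum fun i _ => Finset.sum_le_sum fun j _ => key i j
    _ = ∑ i, u i ^ 2 / p i * ∑ j, W i j * q j + ∑ j, v j ^ 2 / q j * ∑ i, W i j * p i := by
        simp only [Finset.sum_add_distrib, Finset.mul_sum]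
        congr 1
        exact Finset.sum_comm
    _ ≤ ∑ i, u i ^ 2 / p i * (c * p i) + ∑ j, v j ^ 2 / q j * (c * q j) := by
        gcongr with i _ j _
        · have := hp i; positivity
        · exact h1 i
        · have := hq j; positivity
        · exact h2 j
    _ = c * (∑ i, u i ^ 2 + ∑ j, v j ^ 2) := by
        rw [mul_add, Finset.mul_sum, Finset.mul_sum]
        congr 1
        · refine Finset.sum_congr rfl fun i _ => ?_
          have := (hp i).ne'
          field_simp
        · refine Finset.sum_congr rfl fun i _ => ?_
          have := (hq i).ne'
          field_simp

lemma aux_dot {m : Type*} [Fintype m] (u : m → ℝ) : ∑ i, u i ^ 2 = u ⬝ᵥ u := by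
  simp [dotProduct, pow_two]

lemma aux_sigmaMax {m n : Type*} [Fintype m] [Fintype n] (W : Matrix m n ℝ) (c : ℝ) (hc : 0 ≤ c)
    (hU : ∀ u v, 2 * (u ⬝ᵥ W *ᵥ v) ≤ c * (∑ i, u i ^ 2 + ∑ j, v j ^ 2))
    (u : m → ℝ) (v : n → ℝ) (hv : v ≠ 0) (h1 : W *ᵥ v = c • u) (h2 : Wᵀ *ᵥ u = c • v) :
    sigmaMax W = c := by
  have hvv : 0 < v ⬝ᵥ v := by
    have : 0 ≤ v ⬝ᵥ v := by rw [← aux_dot]; positivity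
    exact lt_of_le_of_ne this (fun h => hv (dotProduct_self_eq_zero.mp h.symm))
  apply IsGreatest.csSup_eq
  constructor
  · set s := Real.sqrt (v ⬝ᵥ v) with hs
    have hs0 : 0 < s := Real.sqrt_pos.mpr hvv
    have hss : s ^ 2 = v ⬝ᵥ v := Real.sq_sqrt hvv.le
    refine ⟨s⁻¹ • v, ?_, ?_⟩
    · rw [aux_dot, smul_dotProduct, dotProduct_smul, ← hss]
      simp only [smul_eq_mul]
      field_simp
    · have e : u ⬝ᵥ W *ᵥ v = (Wᵀ *ᵥ u) ⬝ᵥ v := by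
        rw [Matrix.dotProduct_mulVec, Matrix.mulVec_transpose]
      rw [h1, h2, dotProduct_smul, smul_dotProduct, smul_eq_mul, smul_eq_mul] at e
      rw [aux_dot, Matrix.mulVec_smul, smul_dotProduct, dotProduct_smul, h1, smul_dotProduct,
        dotProduct_smul]
      simp only [smul_eq_mul]
      rw [e, ← hss]
      have : s⁻¹ * (s⁻¹ * (c * (c * s ^ 2))) = c ^ 2 := by field_simp
      rw [this, Real.sqrt_sq hc]
  · rintro r ⟨w, hw, rfl⟩
    apply Real.sqrt_le_iff.mpr ⟨hc, ?_⟩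
    have a1 := hU (W *ᵥ w) (c • w)
    have a2 := hU (W *ᵥ w) w
    have e : ∑ j, (c • w) j ^ 2 = c ^ 2 := by
      simp only [Pi.smul_apply, smul_eq_mul, mul_pow, ← Finset.mul_sum, hw, mul_one]
    rw [e, Matrix.mulVec_smul, dotProduct_smul, smul_eq_mul, ← aux_dot] at a1
    rw [hw, ← aux_dot] at a2
    rcases hc.eq_or_lt with h | h
    · rw [← h] at a2 ⊢
      linarith
    · have : c * ∑ i, (W *ᵥ w) i ^ 2 ≤ c * c ^ 2 := by linarith
      exact le_of_mul_le_mul_left this h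

lemma aux_sigmaMin {m n l : Type*} [Fintype m] [Fintype n] [Fintype l] [DecidableEq m]
    [DecidableEq n] (T : Matrix (m ⊕ n) l ℝ) (W : Matrix m n ℝ) (c : ℝ)
    (hT : T * Tᵀ = (2 : ℝ) • (1 : Matrix (m ⊕ n) (m ⊕ n) ℝ) - Matrix.fromBlocks 0 W Wᵀ 0)
    (hU : ∀ u v, 2 * (u ⬝ᵥ W *ᵥ v) ≤ c * (∑ i, u i ^ 2 + ∑ j, v j ^ 2))
    (u : m → ℝ) (v : n → ℝ) (hv : v ≠ 0) (h1 : W *ᵥ v = c • u) (h2 : Wᵀ *ᵥ u = c • v) :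
    sigmaMin T = Real.sqrt (2 - c) := by
  have quad : ∀ x : m ⊕ n → ℝ, ∑ j, (x ᵥ* T) j ^ 2 = 2 * (x ⬝ᵥ x)
      - 2 * ((x ∘ Sum.inl) ⬝ᵥ W *ᵥ (x ∘ Sum.inr)) := by
    intro x
    have e1 : ∑ j, (x ᵥ* T) j ^ 2 = x ⬝ᵥ (T * Tᵀ) *ᵥ x := by
      rw [aux_dot, ← Matrix.mulVec_mulVec, Matrix.dotProduct_mulVec x T, Matrix.mulVec_transpose]
    have e2 : (x ∘ Sum.inr) ⬝ᵥ Wᵀ *ᵥ (x ∘ Sum.inl) = (x ∘ Sum.inl) ⬝ᵥ W *ᵥ (x ∘ Sum.inr) := by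
      rw [Matrix.dotProduct_mulVec, Matrix.vecMul_transpose, dotProduct_comm]
    have e3 : x ⬝ᵥ (Matrix.fromBlocks 0 W Wᵀ 0) *ᵥ x =
        (x ∘ Sum.inl) ⬝ᵥ W *ᵥ (x ∘ Sum.inr) + (x ∘ Sum.inr) ⬝ᵥ Wᵀ *ᵥ (x ∘ Sum.inl) := by
      rw [Matrix.fromBlocks_mulVec]
      simp [dotProduct, Fintype.sum_sum_type]
    rw [e1, hT, Matrix.sub_mulVec, Matrix.smul_mulVec, Matrix.one_mulVec, dotProduct_sub, e3, e2,
      dotProduct_smul, smul_eq_mul]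
    ring
  have hvv : 0 < v ⬝ᵥ v := by
    have : 0 ≤ v ⬝ᵥ v := by rw [← aux_dot]; positivity
    exact lt_of_le_of_ne this (fun h => hv (dotProduct_self_eq_zero.mp h.symm))
  have huu : 0 ≤ u ⬝ᵥ u := by rw [← aux_dot]; positivity
  apply IsLeast.csInf_eq
  constructor
  · have hN : 0 < u ⬝ᵥ u + v ⬝ᵥ v := by linarith
    set s := Real.sqrt (u ⬝ᵥ u + v ⬝ᵥ v) with hs
    have hs0 : 0 < s := Real.sqrt_pos.mpr hN
    have hss : s ^ 2 = u ⬝ᵥ u + v ⬝ᵥ v := Real.sq_sqrt hN.le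
    have hx : (s⁻¹ • Sum.elim u v) ⬝ᵥ (s⁻¹ • Sum.elim u v) = 1 := by
      rw [smul_dotProduct, dotProduct_smul, sumElim_dotProduct_sumElim, ← hss]
      simp only [smul_eq_mul]
      field_simp
    refine ⟨s⁻¹ • Sum.elim u v, ?_, ?_⟩
    · rw [aux_dot, hx]
    · have e : u ⬝ᵥ W *ᵥ v = (Wᵀ *ᵥ u) ⬝ᵥ v := by
        rw [Matrix.dotProduct_mulVec, Matrix.mulVec_transpose]
      rw [h1, h2, dotProduct_smul, smul_dotProduct, smul_eq_mul, smul_eq_mul] at e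
      rw [quad, hx]
      have i1 : (s⁻¹ • Sum.elim u v) ∘ Sum.inl = s⁻¹ • u := by ext; simp
      have i2 : (s⁻¹ • Sum.elim u v) ∘ Sum.inr = s⁻¹ • v := by ext; simp
      rw [i1, i2, Matrix.mulVec_smul, smul_dotProduct, dotProduct_smul, h1, dotProduct_smul]
      simp only [smul_eq_mul]
      have e5 : c * (u ⬝ᵥ u) = c * s ^ 2 / 2 := by rw [hss]; linarith
      rw [e5]
      congr 1
      field_simp
  · rintro r ⟨x, hx, rfl⟩
    apply Real.sqrt_le_sqrt
    have h := hU (x ∘ Sum.inl) (x ∘ Sum.inr)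
    rw [quad, ← aux_dot, hx]
    rw [Fintype.sum_sum_type] at hx
    simp only [Function.comp_apply] at h
    rw [hx] at h
    linarith

lemma aux_trig (θ : ℝ) (s : ℝ) :
    Real.sin ((s + 2) * θ) + Real.sin (s * θ) = 2 * Real.cos θ * Real.sin ((s + 1) * θ) := by
  have e1 : (s + 2) * θ = (s + 1) * θ + θ := by ring
  have e2 : s * θ = (s + 1) * θ - θ := by ring
  rw [e1, e2, Real.sin_add, Real.sin_sub]
  ring

lemma aux_row (k : ℕ) (W : Matrix (Fin k × Fin k) (Fin k × Fin k) ℝ)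
    (hW : ∀ a b a' b' : Fin k, W (a, b) (a', b') = (1 : Matrix (Fin k) (Fin k) ℝ) a a' *
        (if (b' : ℕ) = (b : ℕ) + 1 then 1 else 0) +
      (if (a : ℕ) = (a' : ℕ) + 1 then 1 else 0) * (1 : Matrix (Fin k) (Fin k) ℝ) b b')
    (g : ℕ → ℕ → ℝ) (a b : Fin k) :
    ∑ j : Fin k × Fin k, W (a, b) j * g j.1 j.2 =
      (if (b : ℕ) + 1 < k then g a (b + 1) else 0) + (if 0 < (a : ℕ) then g (a - 1) b else 0) := by
  rw [← aux_sum1 k b (g a), ← aux_sum2 k a (fun x => g x b), Fintype.sum_prod_type]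
  simp only [hW, add_mul, Finset.sum_add_distrib, Matrix.one_apply]
  congr 1
  · rw [Finset.sum_eq_single a]
    · simp
    · intro x _ hx
      simp [hx.symm]
    · simp
  · refine Finset.sum_congr rfl fun x _ => ?_
    rw [Finset.sum_eq_single b]
    · simp
    · intro x _ hx
      simp [hx.symm]
    · simp

lemma aux_col (k : ℕ) (W : Matrix (Fin k × Fin k) (Fin k × Fin k) ℝ)
    (hW : ∀ a b a' b' : Fin k, W (a, b) (a', b') = (1 : Matrix (Fin k) (Fin k) ℝ) a a' *
        (if (b' : ℕ) = (b : ℕ) + 1 then 1 else 0) +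
      (if (a : ℕ) = (a' : ℕ) + 1 then 1 else 0) * (1 : Matrix (Fin k) (Fin k) ℝ) b b')
    (g : ℕ → ℕ → ℝ) (a b : Fin k) :
    ∑ j : Fin k × Fin k, W j (a, b) * g j.1 j.2 =
      (if 0 < (b : ℕ) then g a (b - 1) else 0) +
      (if (a : ℕ) + 1 < k then g (a + 1) b else 0) := by
  rw [← aux_sum2 k b (g a), ← aux_sum1 k a (fun x => g x b), Fintype.sum_prod_type]
  simp only [hW, add_mul, Finset.sum_add_distrib, Matrix.one_apply]
  congr 1
  · rw [Finset.sum_eq_single a]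
    · simp
    · intro x _ hx
      simp [hx]
    · simp
  · refine Finset.sum_congr rfl fun x _ => ?_
    rw [Finset.sum_eq_single b]
    · simp
    · intro x _ hx
      simp [hx]
    · simp

/-- `T̂₃ = [[-I⊗F, -E⊗I],[I⊗E, F⊗I]]` satisfies
`T̂₃ T̂₃ᵀ = 2I - [[0, Ŵ],[Ŵᵀ, 0]]` with `Ŵ = I⊗(F Eᵀ) + (E Fᵀ)⊗I`, and consequently
`σ_min(T̂₃) = √(2 - σ_max(Ŵ)) = √(2 - 2cos(π/(2k))) = 2 sin(π/(4k))`. -/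
theorem sigmaMin_That3 (k : ℕ) (hk : 1 ≤ k)
    (E F : Matrix (Fin k) (Fin (k + 1)) ℝ)
    (hE : ∀ i j, E i j = if (j : ℕ) = (i : ℕ) then 1 else 0)
    (hF : ∀ i j, F i j = if (j : ℕ) = (i : ℕ) + 1 then 1 else 0)
    (T₃ : Matrix ((Fin k × Fin k) ⊕ (Fin k × Fin k))
      ((Fin k × Fin (k + 1)) ⊕ (Fin (k + 1) × Fin k)) ℝ)
    (hT₃ : T₃ = Matrix.fromBlocks
      (-((1 : Matrix (Fin k) (Fin k) ℝ) ⊗ₖ F)) (-(E ⊗ₖ (1 : Matrix (Fin k) (Fin k) ℝ)))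
      ((1 : Matrix (Fin k) (Fin k) ℝ) ⊗ₖ E) (F ⊗ₖ (1 : Matrix (Fin k) (Fin k) ℝ)))
    (W : Matrix (Fin k × Fin k) (Fin k × Fin k) ℝ)
    (hW : W = (1 : Matrix (Fin k) (Fin k) ℝ) ⊗ₖ (F * Eᵀ) +
      (E * Fᵀ) ⊗ₖ (1 : Matrix (Fin k) (Fin k) ℝ)) :
    T₃ * T₃ᵀ = (2 : ℝ) • (1 : Matrix ((Fin k × Fin k) ⊕ (Fin k × Fin k))
        ((Fin k × Fin k) ⊕ (Fin k × Fin k)) ℝ) - Matrix.fromBlocks 0 W Wᵀ 0 ∧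
    sigmaMin T₃ = Real.sqrt (2 - sigmaMax W) ∧
    sigmaMin T₃ = Real.sqrt (2 - 2 * Real.cos (Real.pi / (2 * k))) ∧
    sigmaMin T₃ = 2 * Real.sin (Real.pi / (4 * k)) := by
  have hWe := aux_W k E F hE hF W hW
  have hTT : T₃ * T₃ᵀ = (2 : ℝ) • (1 : Matrix ((Fin k × Fin k) ⊕ (Fin k × Fin k))
        ((Fin k × Fin k) ⊕ (Fin k × Fin k)) ℝ) - Matrix.fromBlocks 0 W Wᵀ 0 := by
    rw [hT₃, hW]
    exact aux_TT k E F (aux_EE k E hE) (aux_FF k F hF)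
  have hk0 : (0 : ℝ) < k := by exact_mod_cast hk
  have hk1 : (1 : ℝ) ≤ k := by exact_mod_cast hk
  obtain ⟨θ, hθ⟩ : ∃ θ, θ = Real.pi / (2 * k) := ⟨_, rfl⟩
  have hθpi : 2 * k * θ = Real.pi := by rw [hθ]; field_simp
  have hθ0 : 0 < θ := by rw [hθ]; positivity
  have hθ2 : θ ≤ Real.pi / 2 := by nlinarith
  have hc : 0 ≤ 2 * Real.cos θ :=
    mul_nonneg zero_le_two (Real.cos_nonneg_of_mem_Icc ⟨by linarith [Real.pi_pos], hθ2⟩)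
  have spos : ∀ n : ℕ, n ≤ 2 * k → 0 ≤ Real.sin (n * θ) := by
    intro n h2
    have : (n : ℝ) ≤ 2 * k := by exact_mod_cast h2
    apply Real.sin_nonneg_of_nonneg_of_le_pi
    · positivity
    · rw [← hθpi]; gcongr
  have spos' : ∀ n : ℕ, 0 < n → n < 2 * k → 0 < Real.sin (n * θ) := by
    intro n h1 h2
    have h2' : (n : ℝ) < 2 * k := by exact_mod_cast h2
    have h1' : (0 : ℝ) < n := by exact_mod_cast h1
    apply Real.sin_pos_of_pos_of_lt_pi
    · positivity
    · rw [← hθpi]; gcongr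
  have tri : ∀ n : ℕ, Real.sin ((n + 2 : ℕ) * θ) + Real.sin (n * θ) =
      2 * Real.cos θ * Real.sin ((n + 1 : ℕ) * θ) := by
    intro n
    push_cast
    exact aux_trig θ n
  obtain ⟨S, hS⟩ : ∃ S : ℕ → ℝ, ∀ n, S n = Real.sin (n * θ) := ⟨_, fun _ => rfl⟩
  simp only [← hS] at spos spos' tri
  have S0 : S 0 = 0 := by simp [hS]
  have S2k : S (2 * k) = 0 := by rw [hS]; push_cast; rw [hθpi, Real.sin_pi]
  have hU : ∀ u v, 2 * (u ⬝ᵥ W *ᵥ v) ≤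
      2 * Real.cos θ * (∑ i, u i ^ 2 + ∑ j, v j ^ 2) := by
    refine aux_schur W _ (fun i => S (i.1 + i.2 + 1)) (fun i => S (i.1 + i.2 + 1)) ?_ ?_ ?_ ?_ ?_
    · intro i
      exact spos' _ (by omega) (by omega)
    · intro i
      exact spos' _ (by omega) (by omega)
    · rintro ⟨a, b⟩ ⟨a', b'⟩
      rw [hWe, Matrix.one_apply, Matrix.one_apply]
      split_ifs <;> norm_num
    · rintro ⟨a, b⟩
      have ha := a.2
      have hb := b.2
      have := aux_row k W hWe (fun x y => S (x + y + 1)) a b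
      simp only at this ⊢
      rw [this, ← tri]
      have p1 := spos (a + b + 2) (by omega)
      have p2 := spos (a + b) (by omega)
      apply add_le_add
      · split_ifs
        · rw [← add_assoc]
        · exact p1
      · split_ifs
        · apply le_of_eq; congr 1; omega
        · exact p2
    · rintro ⟨a, b⟩
      have ha := a.2
      have hb := b.2
      have := aux_col k W hWe (fun x y => S (x + y + 1)) a b
      simp only at this ⊢
      rw [this, ← tri]
      have p1 := spos (a + b + 2) (by omega)
      have p2 := spos (a + b) (by omega)
      rw [add_comm]
      apply add_le_add
      · split_ifs
        · apply le_of_eq; congr 1; omega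
        · exact p1
      · split_ifs
        · apply le_of_eq; congr 1; omega
        · exact p2
  obtain ⟨gv, hgv⟩ : ∃ g : ℕ → ℕ → ℝ, ∀ x y, g x y = if x = y then S (x + y + 1) else 0 :=
    ⟨_, fun _ _ => rfl⟩
  obtain ⟨gu, hgu⟩ : ∃ g : ℕ → ℕ → ℝ, ∀ x y, g x y = if x = y + 1 then S (x + y + 1) else 0 :=
    ⟨_, fun _ _ => rfl⟩
  have hv : (fun i : Fin k × Fin k => gv i.1 i.2) ≠ 0 := by
    intro h
    have h' := congrFun h (⟨0, hk⟩, ⟨0, hk⟩)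
    simp only [hgv, Pi.zero_apply, if_true] at h'
    exact (spos' 1 (by omega) (by omega)).ne' h'
  have h1 : W *ᵥ (fun i : Fin k × Fin k => gv i.1 i.2) =
      (2 * Real.cos θ) • (fun i : Fin k × Fin k => gu i.1 i.2) := by
    ext ⟨a, b⟩
    have ha := a.2
    have hb := b.2
    have := aux_row k W hWe gv a b
    simp only [Matrix.mulVec, dotProduct, Pi.smul_apply, smul_eq_mul]
    rw [this, hgu, hgv, hgv]
    by_cases hab : (a : ℕ) = b + 1
    · rw [if_pos hab, if_pos (by omega), if_pos hab, if_pos (by omega), if_pos (by omega), ← tri]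
      congr 2
      omega
    · rw [if_neg hab, if_neg hab, mul_zero]
      split_ifs <;> first | omega | simp
  have h2 : Wᵀ *ᵥ (fun i : Fin k × Fin k => gu i.1 i.2) =
      (2 * Real.cos θ) • (fun i : Fin k × Fin k => gv i.1 i.2) := by
    ext ⟨a, b⟩
    have ha := a.2
    have hb := b.2
    have := aux_col k W hWe gu a b
    simp only [Matrix.mulVec, dotProduct, Pi.smul_apply, smul_eq_mul, Matrix.transpose_apply]
    rw [this, hgv, hgu, hgu]
    by_cases hab : (a : ℕ) = b
    · rw [if_pos hab, ← tri, add_comm]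
      congr 1
      · rw [if_pos (show (a : ℕ) + 1 = b + 1 by omega)]
        split_ifs with h
        · congr 1; omega
        · rw [← S2k]; congr 1; omega
      · split_ifs with h h'
        · congr 1; omega
        · omega
        · rw [← S0]; congr 1; omega
    · rw [if_neg hab, mul_zero]
      split_ifs <;> first | omega | simp
  have hmax := aux_sigmaMax W _ hc hU _ _ hv h1 h2
  have hmin := aux_sigmaMin T₃ W _ hTT hU _ _ hv h1 h2
  refine ⟨hTT, ?_, ?_, ?_⟩
  · rw [hmin, hmax]
  · rw [hmin, hθ]
  · rw [hmin]
    have e : Real.pi / (4 * k) = θ / 2 := by rw [hθ]; field_simp; norm_num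
    rw [e]
    have e2 : 2 - 2 * Real.cos θ = (2 * Real.sin (θ / 2)) ^ 2 := by
      have h3 : θ = 2 * (θ / 2) := by ring
      have h4 := Real.sin_sq_add_cos_sq (θ / 2)
      have h5 := Real.cos_two_mul (θ / 2)
      rw [← h3] at h5
      rw [h5]
      linarith
    rw [e2, Real.sqrt_sq]
    exact mul_nonneg zero_le_two
      (Real.sin_nonneg_of_nonneg_of_le_pi (by linarith) (by linarith [Real.pi_pos]))
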